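/- Let K be a commutative \mathbb{Q}-algebra, let \zeta be an invertible formal Laurent series in K((z)) such that \zeta' is also invertible, and let D_1, D_2, D_3 be K-linear derivations of K((z)) commuting with d/dz. Then res\big( D_2\zeta \cdot D_3\zeta \cdot D_1(\zeta') / (\zeta')^2 \big) = res\big( (D_2\zeta/\zeta') \cdot (D_3\zeta \cdot D_1\zeta/\zeta')' \big) + res\big( (D_3\zeta/\zeta') \cdot (D_2\zeta \cdot D_1\zeta/\zeta')' \big). -/

import Mathlib

/-- `Df` is the formal derivative of the Laurent series `f`:
its `n`-th coefficient is `(n+1) ⬝ f_{n+1}`. -/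
def IsFormalDeriv {K : Type*} [CommRing K] (f Df : LaurentSeries K) : Prop :=
  ∀ n : ℤ, Df.coeff n = (n + 1) • f.coeff (n + 1)

/-- The formal residue: the coefficient of `z^{-1}`. -/
def formalRes {K : Type*} [CommRing K] (f : LaurentSeries K) : K := f.coeff (-1)

/-- Up to the factor `z`, the formal derivative multiplies the `n`-th coefficient by `n`. -/
theorem IsFormalDeriv.coeff_single_one_mul {K : Type*} [CommRing K] {f Df : LaurentSeries K}
    (h : IsFormalDeriv f Df) (n : ℤ) :
    (HahnSeries.single (1 : ℤ) (1 : K) * Df).coeff n = n • f.coeff n := by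
  have := HahnSeries.coeff_single_mul_add (r := (1 : K)) (x := Df) (a := n - 1) (b := (1 : ℤ))
  rw [sub_add_cancel] at this
  rw [this, h (n - 1)]
  simp

/-- The Leibniz rule for the formal derivative of Laurent series. -/
theorem IsFormalDeriv.mul {K : Type*} [CommRing K] {f g Df Dg Dfg : LaurentSeries K}
    (hf : IsFormalDeriv f Df) (hg : IsFormalDeriv g Dg) (hfg : IsFormalDeriv (f * g) Dfg) :
    Dfg = Df * g + f * Dg := by
  set z : LaurentSeries K := HahnSeries.single (1 : ℤ) (1 : K) with hz
  have hsupp : ∀ {u Du : LaurentSeries K}, IsFormalDeriv u Du →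
      (z * Du).support ⊆ u.support := by
    intro u Du hu n hn hn'
    exact hn (by rw [hu.coeff_single_one_mul, hn', smul_zero])
  have key : z * Dfg = z * Df * g + f * (z * Dg) := by
    ext n
    rw [hfg.coeff_single_one_mul, HahnSeries.coeff_add, HahnSeries.coeff_mul,
      HahnSeries.coeff_mul_left' f.isPWO_support (hsupp hf),
      HahnSeries.coeff_mul_right' g.isPWO_support (hsupp hg),
      Finset.smul_sum, ← Finset.sum_add_distrib]
    refine Finset.sum_congr rfl fun ij hij => ?_
    rw [hf.coeff_single_one_mul, hg.coeff_single_one_mul,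
      ← (Finset.mem_antidiagonal.mp hij).2.2, add_smul, smul_mul_assoc, mul_smul_comm]
  have hinv : HahnSeries.single (-1 : ℤ) (1 : K) * z = 1 := by
    rw [hz, HahnSeries.single_mul_single]
    simp
  linear_combination HahnSeries.single (-1 : ℤ) (1 : K) * key
    + (Df * g + f * Dg - Dfg) * hinv

/-- The residue of a formal derivative vanishes. -/
theorem IsFormalDeriv.formalRes_eq_zero {K : Type*} [CommRing K] {f Df : LaurentSeries K}
    (h : IsFormalDeriv f Df) : formalRes Df = 0 := by
  simp [formalRes, h (-1)]

theorem stmt_11 (K : Type*) [CommRing K] [Algebra ℚ K]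
    (D0 : LaurentSeries K →ₗ[K] LaurentSeries K)
    (hD0 : ∀ f : LaurentSeries K, IsFormalDeriv f (D0 f))
    (D1 D2 D3 : LaurentSeries K →ₗ[K] LaurentSeries K)
    (hL1 : ∀ f g : LaurentSeries K, D1 (f * g) = D1 f * g + f * D1 g)
    (hL2 : ∀ f g : LaurentSeries K, D2 (f * g) = D2 f * g + f * D2 g)
    (hL3 : ∀ f g : LaurentSeries K, D3 (f * g) = D3 f * g + f * D3 g)
    (hC1 : ∀ f : LaurentSeries K, D1 (D0 f) = D0 (D1 f))
    (hC2 : ∀ f : LaurentSeries K, D2 (D0 f) = D0 (D2 f))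
    (hC3 : ∀ f : LaurentSeries K, D3 (D0 f) = D0 (D3 f))
    (zeta xi : LaurentSeries K) (hzeta : IsUnit zeta) (hxi : D0 zeta * xi = 1) :
    formalRes (D2 zeta * D3 zeta * D1 (D0 zeta) * xi ^ 2)
      = formalRes ((D2 zeta * xi) * D0 (D3 zeta * D1 zeta * xi))
        + formalRes ((D3 zeta * xi) * D0 (D2 zeta * D1 zeta * xi)) := by
  have leib (f g : LaurentSeries K) : D0 (f * g) = D0 f * g + f * D0 g :=
    (hD0 f).mul (hD0 g) (hD0 (f * g))
  have hsum : (D2 zeta * xi) * D0 (D3 zeta * D1 zeta * xi)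
      + (D3 zeta * xi) * D0 (D2 zeta * D1 zeta * xi)
      = D2 zeta * D3 zeta * D1 (D0 zeta) * xi ^ 2
        + D0 (D1 zeta * D2 zeta * D3 zeta * (xi * xi)) := by
    rw [hC1]
    simp only [leib]
    ring
  have hres := (hD0 (D1 zeta * D2 zeta * D3 zeta * (xi * xi))).formalRes_eq_zero
  unfold formalRes at hres ⊢
  rw [← HahnSeries.coeff_add, hsum, HahnSeries.coeff_add, hres, add_zero]
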